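/- For all natural numbers r ≥ 2, d ≥ 1 and s ≥ (r−1)(d+1) + 2, there exists a₀ ∈ ℕ such that for all integers a ≥ a₀, Σ_{r,d}(a, s+1) − Σ_{r,d}(a, s) − 1 < (a + (r − 2 + x_{r★}(a,d))/(r−1)) · s. -/

import Mathlib

open Finset

/-- Sum of the edge multiplicities of the multigraph `w` inside the vertex set `X`
(edges are 2-element subsets of `Fin n`). -/
def edgeSum (n : ℕ) (w : Finset (Fin n) → ℕ) (X : Finset (Fin n)) : ℕ :=
  ∑ p ∈ X.powersetCard 2, w p

/-- Product of the edge multiplicities of the multigraph `w` inside the vertex set `X`. -/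
def edgeProd (n : ℕ) (w : Finset (Fin n) → ℕ) (X : Finset (Fin n)) : ℕ :=
  ∏ p ∈ X.powersetCard 2, w p

/-- The product-degree of the vertex `v` in the multigraph `w`. -/
def pdeg (n : ℕ) (w : Finset (Fin n) → ℕ) (v : Fin n) : ℕ :=
  ∏ u ∈ Finset.univ.erase v, w {u, v}

/-- `w` is an `(n,s,q)`-graph: every `s`-set of vertices spans at most `q` edges. -/
def IsF (n s q : ℕ) (w : Finset (Fin n) → ℕ) : Prop :=
  ∀ X : Finset (Fin n), X.card = s → edgeSum n w X ≤ q

/-- `ex_Π(n,s,q)`: the maximum of the product of all edge multiplicities over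
`(n,s,q)`-graphs. -/
noncomputable def exPi (n s q : ℕ) : ℕ :=
  sSup {P | ∃ w : Finset (Fin n) → ℕ, IsF n s q w ∧ P = edgeProd n w Finset.univ}

/-- Membership in the family `T_{r,d}(a,n)`: the vertex set can be partitioned into
parts `V_0, …, V_{r-1}` (given by a labelling `f`) so that edges inside `V_0` have
multiplicity `a - d`, edges inside `V_i` (`i ≥ 1`) have multiplicity `a`, and edges
between distinct parts have multiplicity `a + 1`. -/
def InT (n r d a : ℕ) (w : Finset (Fin n) → ℕ) : Prop :=
  ∃ f : Fin n → ℕ, (∀ v, f v < r) ∧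
    ∀ u v : Fin n, u ≠ v →
      w {u, v} = if f u = f v then (if f u = 0 then a - d else a) else a + 1

/-- `Σ_{r,d}(a,n)`: the maximum number of edges of a member of `T_{r,d}(a,n)`. -/
noncomputable def SigmaT (r d a n : ℕ) : ℕ :=
  sSup {e | ∃ w : Finset (Fin n) → ℕ, InT n r d a w ∧ e = edgeSum n w Finset.univ}

/-- `Π_{r,d}(a,n)`: the maximum product of edge multiplicities of a member of
`T_{r,d}(a,n)`. -/
noncomputable def PiT (r d a n : ℕ) : ℕ :=
  sSup {P | ∃ w : Finset (Fin n) → ℕ, InT n r d a w ∧ P = edgeProd n w Finset.univ}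

/-- `x_{r★}(a,d) = log((a+1)/a) / log((a+1)^r / (a (a-d)^{r-1}))`. -/
noncomputable def xstar (r a d : ℕ) : ℝ :=
  Real.log (((a : ℝ) + 1) / (a : ℝ)) /
    Real.log (((a : ℝ) + 1) ^ r / ((a : ℝ) * ((a : ℝ) - (d : ℝ)) ^ (r - 1)))

/-- In a member of `T_{r,d}(a,n)` all multiplicities are at most `a + 1`. -/
theorem InT.le_succ {n r d a : ℕ} {w : Finset (Fin n) → ℕ} (hw : InT n r d a w)
    {p : Finset (Fin n)} (hp : p.card = 2) : w p ≤ a + 1 := by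
  obtain ⟨f, -, hf⟩ := hw
  obtain ⟨u, v, huv, rfl⟩ := Finset.card_eq_two.1 hp
  rw [hf u v huv]
  split_ifs <;> omega

theorem bddAbove_edgeSum_inT (r d a n : ℕ) :
    BddAbove {e | ∃ w : Finset (Fin n) → ℕ, InT n r d a w ∧ e = edgeSum n w Finset.univ} := by
  refine ⟨((univ : Finset (Fin n)).powersetCard 2).card * (a + 1), ?_⟩
  rintro _ ⟨w, hw, rfl⟩
  rw [edgeSum, ← smul_eq_mul]
  exact Finset.sum_le_card_nsmul _ _ _ fun p hp => hw.le_succ (mem_powersetCard.1 hp).2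

theorem InT.edgeSum_le_SigmaT {n r d a : ℕ} {w : Finset (Fin n) → ℕ} (hw : InT n r d a w) :
    edgeSum n w Finset.univ ≤ SigmaT r d a n :=
  le_csSup (bddAbove_edgeSum_inT r d a n) ⟨w, hw, rfl⟩

theorem exists_inT_edgeSum_eq_SigmaT {r : ℕ} (hr : 0 < r) (d a n : ℕ) :
    ∃ w : Finset (Fin n) → ℕ, InT n r d a w ∧ SigmaT r d a n = edgeSum n w Finset.univ := by
  refine Nat.sSup_mem (s := {e | ∃ w, InT n r d a w ∧ e = edgeSum n w Finset.univ}) ?_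
    (bddAbove_edgeSum_inT r d a n)
  exact ⟨_, fun _ => a - d, ⟨fun _ => 0, fun _ => hr, fun _ _ _ => by simp⟩, rfl⟩

/-- The restriction of a member of `T_{r,d}(a,n)` along an embedding of vertex sets belongs to
`T_{r,d}(a,m)`. -/
theorem InT.comap {m n r d a : ℕ} {w : Finset (Fin n) → ℕ} (hw : InT n r d a w)
    (φ : Fin m ↪ Fin n) : InT m r d a fun p => w (p.map φ) := by
  obtain ⟨f, hfr, hf⟩ := hw
  refine ⟨f ∘ φ, fun v => hfr _, fun u v huv => ?_⟩
  have := hf (φ u) (φ v) (φ.injective.ne huv)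
  simpa [Finset.map_insert] using this

theorem edgeSum_map {m n : ℕ} (w : Finset (Fin n) → ℕ) (φ : Fin m ↪ Fin n)
    (X : Finset (Fin m)) :
    edgeSum m (fun p => w (p.map φ)) X = edgeSum n w (X.map φ) := by
  rw [edgeSum, edgeSum, powersetCard_map, sum_map]
  rfl

theorem edgeSum_univ_eq_erase_add {n : ℕ} (w : Finset (Fin n) → ℕ) (v : Fin n) :
    edgeSum n w univ = edgeSum n w (univ.erase v) + ∑ u ∈ univ.erase v, w {v, u} := by
  have hv : v ∉ (univ : Finset (Fin n)).erase v := notMem_erase _ _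
  conv_lhs => rw [edgeSum, ← insert_erase (mem_univ v), powersetCard_succ_insert hv]
  rw [sum_union, edgeSum]
  · congr 1
    rw [sum_image, powersetCard_one, sum_map]
    · rfl
    · intro x hx y hy hxy
      rw [← erase_insert (fun h => hv ((mem_powersetCard.1 hx).1 h)), hxy,
        erase_insert (fun h => hv ((mem_powersetCard.1 hy).1 h))]
  · rw [disjoint_left]
    intro p hp hp'
    obtain ⟨q, -, rfl⟩ := mem_image.1 hp'
    exact hv ((mem_powersetCard.1 hp).1 (mem_insert_self _ _))

/-- The sum-degree of a vertex `v` falls short of `(a + 1) (n - 1)` by the size of the rest of its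
part, weighted by `d + 1` if the part is `V_0`. -/
theorem sum_erase_add_eq {n d a : ℕ} (hda : d ≤ a) {w : Finset (Fin n) → ℕ} {f : Fin n → ℕ}
    (hf : ∀ u v : Fin n, u ≠ v →
      w {u, v} = if f u = f v then (if f u = 0 then a - d else a) else a + 1) (v : Fin n) :
    ∑ u ∈ univ.erase v, w {v, u}
        + (if f v = 0 then d + 1 else 1) * (#{u | f u = f v} - 1) = (a + 1) * (n - 1) := by
  have hcard : #{u | f u = f v} - 1 = #{u ∈ univ.erase v | f u = f v} := by
    rw [filter_erase, card_erase_of_mem (by simp)]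
  rw [hcard, card_filter, mul_sum, ← sum_add_distrib]
  have h : ∀ u ∈ univ.erase v, w {v, u} + (if f v = 0 then d + 1 else 1) *
      (if f u = f v then 1 else 0) = a + 1 := by
    intro u hu
    rw [hf v u (ne_of_mem_erase hu).symm]
    split_ifs <;> omega
  rw [sum_congr rfl h]
  simp [mul_comm]

/-- Removing a vertex of minimum degree from an extremal member of `T_{r,d}(a,s+1)` bounds the
increment of `Σ_{r,d}(a,·)`. -/
theorem exists_SigmaT_succ_add_le {r d a : ℕ} (s : ℕ) (hr : 2 ≤ r) (hda : d ≤ a) :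
    ∃ D : ℕ, SigmaT r d a (s + 1) + D ≤ SigmaT r d a s + (a + 1) * s ∧
      s * (d + 1) + 1 ≤ ((r - 1) * (d + 1) + 1) * (D + 1) := by
  obtain ⟨w, hw, hS⟩ := exists_inT_edgeSum_eq_SigmaT (by omega : 0 < r) d a (s + 1)
  obtain ⟨f, hfr, hf⟩ := id hw
  set c : Fin (s + 1) → ℕ := fun v => (if f v = 0 then d + 1 else 1) * (#{u | f u = f v} - 1)
    with hc
  obtain ⟨v, -, hv⟩ := exists_max_image univ c univ_nonempty
  refine ⟨c v, ?_, ?_⟩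
  · have h1 := (hw.comap (Fin.succAboveEmb v)).edgeSum_le_SigmaT
    have h2 : (univ : Finset (Fin s)).map (Fin.succAboveEmb v) = univ.erase v := by
      ext x
      simp [Fin.exists_succAbove_eq_iff]
    rw [edgeSum_map, h2] at h1
    have h3 : _ + c v = _ := sum_erase_add_eq hda hf v
    have h4 := edgeSum_univ_eq_erase_add w v
    simp only [add_tsub_cancel_right] at h3
    omega
  · have hpart : ∀ i, (if i = 0 then d + 1 else 1) * (#{u | f u = i} - 1) ≤ c v := by
      intro i
      by_cases hi : ∃ u, f u = i
      · obtain ⟨u, rfl⟩ := hi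
        exact hv u (mem_univ u)
      · push Not at hi
        simp [hi]
    have htot : s + 1 = ∑ i ∈ range r, #{u | f u = i} := by
      rw [← card_eq_sum_card_fiberwise (fun u _ => by simpa using hfr u)]
      simp
    obtain ⟨k, rfl⟩ : ∃ k, r = k + 1 := ⟨r - 1, by omega⟩
    rw [sum_range_succ'] at htot
    have h0 := hpart 0
    simp only [if_true] at h0
    have hsum : ∑ i ∈ range k, #{u | f u = i + 1} ≤ k * (c v + 1) := by
      refine (sum_le_card_nsmul _ _ (c v + 1) fun i _ => ?_).trans (by simp)
      have := hpart (i + 1)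
      simp at this
      omega
    have h0' : (d + 1) * #{u | f u = 0} ≤ c v + (d + 1) := by
      rw [Nat.mul_sub, mul_one] at h0
      omega
    simp only [add_tsub_cancel_right]
    have := Nat.mul_le_mul_left (d + 1) hsum
    nlinarith

/-- `x_{r★}(a,d) → 1 / ((r-1)(d+1)+1)` as `a → ∞`. -/
theorem tendsto_xstar {r : ℕ} (hr : 1 ≤ r) (d : ℕ) :
    Filter.Tendsto (fun a : ℕ => xstar r a d) Filter.atTop
      (nhds (1 / (((r : ℝ) - 1) * (d + 1) + 1))) := by
  have hr' : (1 : ℝ) ≤ r := by exact_mod_cast hr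
  have h1 := (Real.tendsto_mul_log_one_add_div_atTop 1).comp (tendsto_natCast_atTop_atTop (R := ℝ))
  have h2 := (Real.tendsto_mul_log_one_add_div_atTop (-d)).comp
    (tendsto_natCast_atTop_atTop (R := ℝ))
  have hne : ((r : ℝ) * 1 - (r - 1) * -(d : ℝ)) ≠ 0 := by
    have : 0 ≤ ((r : ℝ) - 1) * d := mul_nonneg (by linarith) (by positivity)
    nlinarith
  have h := h1.div ((h1.const_mul (r : ℝ)).sub (h2.const_mul ((r : ℝ) - 1))) hne
  have hlim : (1 : ℝ) / ((r : ℝ) * 1 - (r - 1) * -(d : ℝ)) = 1 / (((r : ℝ) - 1) * (d + 1) + 1) := by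
    congr 1
    ring
  rw [hlim] at h
  refine h.congr' ?_
  filter_upwards [Filter.eventually_gt_atTop d] with a ha
  have had : (0 : ℝ) < a - d := by
    have : (d : ℝ) < a := by exact_mod_cast ha
    linarith
  have ha0 : (0 : ℝ) < a := by exact_mod_cast (Nat.zero_le d).trans_lt ha
  have e1 : 1 + 1 / (a : ℝ) = (a + 1) / a := by field_simp
  have e2 : 1 + -(d : ℝ) / a = (a - d) / a := by field_simp; ring
  simp only [Function.comp_apply, Pi.div_apply, xstar]
  rw [e1, e2, Real.log_div (by positivity : ((a : ℝ) + 1) ^ r ≠ 0) (by positivity),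
    Real.log_mul ha0.ne' (by positivity), Real.log_pow, Real.log_pow,
    Real.log_div (by positivity) ha0.ne', Real.log_div had.ne' ha0.ne', Nat.cast_sub hr,
    Nat.cast_one]
  refine Eq.trans ?_ (mul_div_mul_left _ _ ha0.ne')
  congr 1
  ring

/-- For all `r ≥ 2`, `d ≥ 1` and `s ≥ (r-1)(d+1)+2` there exists `a₀` such that for
all `a ≥ a₀`,
`Σ_{r,d}(a,s+1) - Σ_{r,d}(a,s) - 1 < (a + (r-2+x_{r★}(a,d))/(r-1))·s`. -/
theorem sigma_diff_bound (r d s : ℕ) (hr : 2 ≤ r) (hd : 1 ≤ d)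
    (hs : (r - 1) * (d + 1) + 2 ≤ s) :
    ∃ a₀ : ℕ, ∀ a : ℕ, a₀ ≤ a →
      (SigmaT r d a (s + 1) : ℝ) - (SigmaT r d a s : ℝ) - 1
        < ((a : ℝ) + ((r : ℝ) - 2 + xstar r a d) / ((r : ℝ) - 1)) * (s : ℝ) := by
  have hr1 : (1 : ℝ) ≤ (r : ℝ) - 1 := by
    have : (2 : ℝ) ≤ r := by exact_mod_cast hr
    linarith
  have hq : (0 : ℝ) < ((r : ℝ) - 1) * (d + 1) + 1 := by positivity
  have hlim := (((tendsto_xstar (by omega : 1 ≤ r) d).const_sub 1).const_mul (s : ℝ)).div_const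
    ((r : ℝ) - 1)
  have hlt : (s : ℝ) * (1 - 1 / (((r : ℝ) - 1) * (d + 1) + 1)) / ((r : ℝ) - 1)
      < (s * (d + 1) + 1) / (((r : ℝ) - 1) * (d + 1) + 1) := by
    have : (s : ℝ) * (1 - 1 / (((r : ℝ) - 1) * (d + 1) + 1)) / ((r : ℝ) - 1)
        = s * (d + 1) / (((r : ℝ) - 1) * (d + 1) + 1) := by
      have : (r : ℝ) - 1 ≠ 0 := by positivity
      field_simp
      ring
    rw [this]
    gcongr
    linarith
  obtain ⟨a₁, ha₁⟩ := Filter.eventually_atTop.1 (hlim.eventually_lt_const hlt)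
  refine ⟨max a₁ d, fun a ha => ?_⟩
  obtain ⟨D, hD, hDs⟩ := exists_SigmaT_succ_add_le s hr ((le_max_right _ _).trans ha)
  have hx := ha₁ a ((le_max_left _ _).trans ha)
  have hD' : (SigmaT r d a (s + 1) : ℝ) + D ≤ SigmaT r d a s + (a + 1) * s := by
    exact_mod_cast hD
  have hDs' : (s : ℝ) * (d + 1) + 1 ≤ (((r : ℝ) - 1) * (d + 1) + 1) * (D + 1) := by
    have := (Nat.cast_le (α := ℝ)).2 hDs
    push_cast [Nat.cast_sub (by omega : 1 ≤ r)] at this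
    exact this
  have hDx := hx.trans_le ((div_le_iff₀' hq).2 hDs')
  have heq : ((a : ℝ) + ((r : ℝ) - 2 + xstar r a d) / ((r : ℝ) - 1)) * (s : ℝ)
      = (a + 1) * s - s * (1 - xstar r a d) / ((r : ℝ) - 1) := by
    have : (r : ℝ) - 1 ≠ 0 := by positivity
    field_simp
    ring
  rw [heq]
  linarith
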